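/- Let f : ℝ → ℝ be defined by f(y) = 1 for y ≤ 0 and f(y) = sin(π/y) for y > 0, and suppose y₀ : ℝ → ℝ is a continuous function satisfying y₀(x) = ∫_0^x f(y₀(t)) dt for every x ∈ ℝ. Then there exists x₀ > 0 such that y₀(x₀) > 0. -/

import Mathlib

open MeasureTheory Set Filter Topology

/-- `g : ℝ → ℝ` is quasicontinuous: for every point `y`, every `ε > 0` and every open
neighborhood `U` of `y` there is a nonempty open `V ⊆ U` with `|g t − g y| < ε` on `V`. -/
def QuasiContinuous (g : ℝ → ℝ) : Prop :=
  ∀ y : ℝ, ∀ ε : ℝ, 0 < ε → ∀ U : Set ℝ, IsOpen U → y ∈ U →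
    ∃ V : Set ℝ, V.Nonempty ∧ IsOpen V ∧ V ⊆ U ∧ ∀ t ∈ V, |g t - g y| < ε

/-- `g` is upper semicontinuous at `y₀` (ε-δ formulation). -/
def UpperSemicontinuousPt (g : ℝ → ℝ) (y₀ : ℝ) : Prop :=
  ∀ ε : ℝ, 0 < ε → ∃ δ : ℝ, 0 < δ ∧ ∀ y : ℝ, |y - y₀| < δ → g y ≤ g y₀ + ε

/-- Lebesgue measurability: measurability with respect to the completed Lebesgue measure. -/
def LebMeasurable (g : ℝ → ℝ) : Prop :=
  MeasureTheory.NullMeasurable g (volume : Measure ℝ)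

/-- Lebesgue measurability on a subset `s` of `ℝ`. -/
def LebMeasurableOn (g : ℝ → ℝ) (s : Set ℝ) : Prop :=
  MeasureTheory.NullMeasurable g ((volume : Measure ℝ).restrict s)

theorem sine_function_solution_positive (f : ℝ → ℝ)
    (hf : ∀ y : ℝ, f y = if y ≤ 0 then 1 else Real.sin (Real.pi / y))
    (y₀ : ℝ → ℝ) (hcont : Continuous y₀)
    (heq : ∀ x : ℝ, y₀ x = ∫ t in (0:ℝ)..x, f (y₀ t)) :
    ∃ x₀ : ℝ, 0 < x₀ ∧ 0 < y₀ x₀ := by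
  by_contra! hneg
  have hone : y₀ 1 = 1 := by
    rw [heq 1, intervalIntegral.integral_congr_uIoo (g := fun _ => (1 : ℝ))]
    · simp
    · intro t ht
      rw [uIoo_of_le zero_le_one] at ht
      simp [hf, hneg t ht.1]
  linarith [hneg 1 one_pos]
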